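/- Under the Tobit model, if E[‖X‖²] < ∞, then the conditional information equality holds at the true parameters: E[ s(Y, X, D; δ₀, γ₀) · s(Y, X, D; δ₀, γ₀)ᵀ | X ] = −E[ H(Y, X, D; δ₀, γ₀) | X ] almost surely, where the conditional expectations (taken entrywise) are with respect to the σ-algebra generated by X. -/

import Mathlib

open MeasureTheory ProbabilityTheory Real Filter Set

noncomputable section

/-- The standard normal density `φ`. -/
def gPDF (t : ℝ) : ℝ := (Real.sqrt (2 * Real.pi))⁻¹ * Real.exp (-t ^ 2 / 2)

/-- The standard normal cumulative distribution function `Φ`. -/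
def gCDF (t : ℝ) : ℝ := ∫ s in Set.Iic t, gPDF s

/-- The inverse Mills ratio `λ(v) = φ(v)/(1 - Φ(v))`. -/
def mills (v : ℝ) : ℝ := gPDF v / (1 - gCDF v)

/-- Euclidean norm of a vector in `ℝ^n`. -/
def vnorm {n : ℕ} (x : Fin n → ℝ) : ℝ := Real.sqrt (∑ i, (x i) ^ 2)

/-- Frobenius (Euclidean) norm of a real matrix. -/
def frob {m n : Type*} [Fintype m] [Fintype n] (M : Matrix m n ℝ) : ℝ :=
  Real.sqrt (∑ i, ∑ j, (M i j) ^ 2)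

/-- Dot product `xᵀδ`. -/
def dotp {n : ℕ} (x δ : Fin n → ℝ) : ℝ := ∑ i, x i * δ i

/-- The block matrix `[[x xᵀ, -y·x], [-y·xᵀ, γ⁻² + y²]]`. -/
def blockA (K : ℕ) (x : Fin K → ℝ) (y γ : ℝ) :
    Matrix (Fin K ⊕ Unit) (Fin K ⊕ Unit) ℝ :=
  Matrix.fromBlocks (Matrix.vecMulVec x x) (Matrix.of fun i _ => -(y * x i))
    (Matrix.of fun _ j => -(y * x j)) (Matrix.of fun _ _ => γ⁻¹ ^ 2 + y ^ 2)

/-- The block matrix `[[x xᵀ, -c·x], [-c·xᵀ, c²]]`. -/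
def blockB (K : ℕ) (x : Fin K → ℝ) (c : ℝ) :
    Matrix (Fin K ⊕ Unit) (Fin K ⊕ Unit) ℝ :=
  Matrix.fromBlocks (Matrix.vecMulVec x x) (Matrix.of fun i _ => -(c * x i))
    (Matrix.of fun _ j => -(c * x j)) (Matrix.of fun _ _ => c ^ 2)

/-- The Hessian of the reparameterized log conditional likelihood of the truncated
regression model, `H(y, x; δ, γ)` with `v = γc - xᵀδ`. -/
def truncHess (K : ℕ) (c y : ℝ) (x δ : Fin K → ℝ) (γ : ℝ) :
    Matrix (Fin K ⊕ Unit) (Fin K ⊕ Unit) ℝ :=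
  -(blockA K x y γ) +
    (mills (γ * c - dotp x δ) * (mills (γ * c - dotp x δ) - (γ * c - dotp x δ))) • blockB K x c

/-- The Hessian of the reparameterized log conditional likelihood of the Tobit model,
`H(y, x, d; δ, γ)` with `v = γc - xᵀδ`. -/
def tobitHess (K : ℕ) (c y : ℝ) (x : Fin K → ℝ) (d : ℝ) (δ : Fin K → ℝ) (γ : ℝ) :
    Matrix (Fin K ⊕ Unit) (Fin K ⊕ Unit) ℝ :=
  -((1 - d) • blockA K x y γ) -
    (d * mills (-(γ * c - dotp x δ)) * (mills (-(γ * c - dotp x δ)) + (γ * c - dotp x δ))) •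
      blockB K x c

/-- The score of the reparameterized log conditional likelihood of the Tobit model,
`s(y, x, d; δ, γ)` with `v = γc - xᵀδ`. -/
def tobitScore (K : ℕ) (c y : ℝ) (x : Fin K → ℝ) (d : ℝ) (δ : Fin K → ℝ) (γ : ℝ) :
    Fin K ⊕ Unit → ℝ := fun j =>
  (1 - d) *
      Sum.elim (fun i => (γ * y - dotp x δ) * x i) (fun _ => 1 / γ - (γ * y - dotp x δ) * y) j
    + d * mills (-(γ * c - dotp x δ)) * Sum.elim (fun i => -x i) (fun _ => c) j

open scoped NNReal

lemma gPDF_eq_gaussianPDFReal (t : ℝ) : gPDF t = gaussianPDFReal 0 1 t := by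
  simp [gPDF, gaussianPDFReal]

lemma gPDF_pos (t : ℝ) : 0 < gPDF t := by
  unfold gPDF; positivity

lemma gPDF_neg (t : ℝ) : gPDF (-t) = gPDF t := by
  simp [gPDF]

lemma continuous_gPDF : Continuous gPDF := by
  unfold gPDF; fun_prop

lemma integrable_gPDF : Integrable gPDF := by
  rw [funext gPDF_eq_gaussianPDFReal]
  exact integrable_gaussianPDFReal 0 1

lemma integral_gPDF : ∫ s, gPDF s = 1 := by
  simpa only [← gPDF_eq_gaussianPDFReal] using
    integral_gaussianPDFReal_eq_one 0 (one_ne_zero : (1 : ℝ≥0) ≠ 0)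

lemma hasDerivAt_gPDF (t : ℝ) : HasDerivAt gPDF (-t * gPDF t) t := by
  have h : HasDerivAt (fun s : ℝ => -s ^ 2 / 2) (-t) t := by
    convert! ((hasDerivAt_pow 2 t).neg.div_const 2) using 1
    simp; ring
  unfold gPDF
  convert! h.exp.const_mul (Real.sqrt (2 * Real.pi))⁻¹ using 1
  ring

lemma gCDF_eq_gaussianReal_real (v : ℝ) : gCDF v = (gaussianReal 0 1).real (Iic v) := by
  rw [measureReal_def, gaussianReal_apply_eq_integral 0 one_ne_zero, ENNReal.toReal_ofReal]
  · simp only [gCDF, gPDF_eq_gaussianPDFReal]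
  · exact integral_nonneg fun t => gaussianPDFReal_nonneg 0 1 t

lemma one_sub_gCDF_neg (v : ℝ) : 1 - gCDF (-v) = gCDF v := by
  have h1 := intervalIntegral.integral_Iic_add_Ioi (b := -v) integrable_gPDF.integrableOn
    integrable_gPDF.integrableOn
  have h2 := integral_comp_neg_Iic v gPDF
  simp only [gPDF_neg] at h2
  rw [integral_gPDF] at h1
  simp only [gCDF]
  linarith

lemma mills_neg (v : ℝ) : mills (-v) = gPDF v / gCDF v := by
  rw [mills, one_sub_gCDF_neg, gPDF_neg]

lemma monotone_gCDF : Monotone gCDF := fun a b h => by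
  simp only [gCDF_eq_gaussianReal_real]
  exact measureReal_mono (Iic_subset_Iic.2 h)

lemma measurable_mills : Measurable mills := by
  unfold mills
  exact continuous_gPDF.measurable.div (measurable_const.sub monotone_gCDF.measurable)

lemma le_gCDF (v : ℝ) :
    (Real.sqrt (2 * Real.pi))⁻¹ * Real.exp (-(|v| + 1) ^ 2 / 2) ≤ gCDF v := by
  have h1 : ∫ s in Icc (v - 1) v, gPDF s ≤ gCDF v :=
    setIntegral_mono_set integrable_gPDF.integrableOn (ae_of_all _ fun t => (gPDF_pos t).le)
      (Icc_subset_Iic_self.eventuallyLE)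
  refine le_trans ?_ h1
  have h2 := setIntegral_mono_on (μ := volume) (s := Icc (v - 1) v)
    (f := fun _ => (Real.sqrt (2 * Real.pi))⁻¹ * Real.exp (-(|v| + 1) ^ 2 / 2)) (g := gPDF)
    (integrableOn_const (by simp)) integrable_gPDF.integrableOn measurableSet_Icc ?_
  · simpa using h2
  · intro x hx
    have : |x| ≤ |v| + 1 := by
      rw [abs_le]; constructor <;> linarith [hx.1, hx.2, le_abs_self v, neg_abs_le v]
    unfold gPDF
    rw [← sq_abs x]
    gcongr

lemma gCDF_pos (v : ℝ) : 0 < gCDF v :=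
  lt_of_lt_of_le (by positivity) (le_gCDF v)

lemma gPDF_mul_mills_neg_le (v : ℝ) :
    gPDF v * mills (-v) ≤ (Real.sqrt (2 * Real.pi))⁻¹ * Real.exp 1 := by
  rw [mills_neg, mul_div_assoc', div_le_iff₀ (gCDF_pos v)]
  refine le_trans ?_ (mul_le_mul_of_nonneg_left (le_gCDF v) (by positivity))
  unfold gPDF
  have h : Real.exp (-v ^ 2 / 2) * Real.exp (-v ^ 2 / 2) ≤
      Real.exp 1 * Real.exp (-(|v| + 1) ^ 2 / 2) := by
    rw [← Real.exp_add, ← Real.exp_add, Real.exp_le_exp, ← sq_abs v]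
    nlinarith [sq_nonneg (|v| - 1)]
  calc _ = (Real.sqrt (2 * Real.pi))⁻¹ ^ 2 * (Real.exp (-v ^ 2 / 2) * Real.exp (-v ^ 2 / 2)) := by
        ring
    _ ≤ (Real.sqrt (2 * Real.pi))⁻¹ ^ 2 * (Real.exp 1 * Real.exp (-(|v| + 1) ^ 2 / 2)) := by
        gcongr
    _ = _ := by ring

lemma abs_mul_gPDF_le (v : ℝ) : |v| * gPDF v ≤ (Real.sqrt (2 * Real.pi))⁻¹ := by
  have h : |v| * Real.exp (-v ^ 2 / 2) ≤ 1 := by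
    rw [neg_div, Real.exp_neg, mul_inv_le_iff₀ (Real.exp_pos _), one_mul]
    have := Real.add_one_le_exp (v ^ 2 / 2)
    nlinarith [sq_nonneg (|v| - 1), sq_abs v]
  unfold gPDF
  calc _ = (Real.sqrt (2 * Real.pi))⁻¹ * (|v| * Real.exp (-v ^ 2 / 2)) := by ring
    _ ≤ _ := mul_le_of_le_one_right (by positivity) h

lemma integrable_pow_gaussianReal (n : ℕ) : Integrable (fun u : ℝ => u ^ n) (gaussianReal 0 1) := by
  have h := memLp_id_gaussianReal (μ := 0) (v := 1) (n : ℝ≥0)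
  rcases Nat.eq_zero_or_pos n with rfl | hn
  · simp
  · refine (integrable_norm_iff (by fun_prop)).1 ?_
    simpa using h.integrable_norm_pow'

lemma integrable_gaussianReal_iff (f : ℝ → ℝ) :
    Integrable f (gaussianReal 0 1) ↔ Integrable (fun u => gPDF u * f u) := by
  rw [gaussianReal_of_var_ne_zero 0 one_ne_zero,
    integrable_withDensity_iff_integrable_smul' (measurable_gaussianPDF 0 1)
      (ae_of_all _ fun _ => gaussianPDF_lt_top)]
  simp [toReal_gaussianPDF, gPDF_eq_gaussianPDFReal]

lemma setIntegral_gaussianReal (f : ℝ → ℝ) {s : Set ℝ} (hs : MeasurableSet s) :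
    ∫ u in s, f u ∂gaussianReal 0 1 = ∫ u in s, gPDF u * f u := by
  rw [← integral_indicator hs, integral_gaussianReal_eq_integral_smul one_ne_zero,
    ← integral_indicator hs]
  congr 1 with u
  by_cases hu : u ∈ s <;> simp [hu, gPDF_eq_gaussianPDFReal]

/-- Gaussian integration by parts on a half line. -/
lemma setIntegral_Ioi_gaussianReal_stein {f f' : ℝ → ℝ} (v : ℝ)
    (hf : ∀ u, HasDerivAt f (f' u) u) (hint : Integrable f (gaussianReal 0 1))
    (hint' : Integrable (fun u => u * f u - f' u) (gaussianReal 0 1)) :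
    ∫ u in Ioi v, (u * f u - f' u) ∂gaussianReal 0 1 = f v * gPDF v := by
  rw [setIntegral_gaussianReal _ measurableSet_Ioi]
  have hd : ∀ u, HasDerivAt (fun u => -(gPDF u * f u)) (gPDF u * (u * f u - f' u)) u := fun u => by
    convert! ((hasDerivAt_gPDF u).mul (hf u)).neg using 1
    ring
  have hi := ((integrable_gaussianReal_iff f).1 hint).neg.integrableOn (s := Ioi v)
  have hi' := ((integrable_gaussianReal_iff _).1 hint').integrableOn (s := Ioi v)
  have hl := tendsto_zero_of_hasDerivAt_of_integrableOn_Ioi (fun x _ => hd x) hi' hi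
  rw [integral_Ioi_of_hasDerivAt_of_tendsto' (fun x _ => hd x) hi' hl]
  ring

lemma gCDF_mul_mills_neg (v : ℝ) : gCDF v * mills (-v) = gPDF v := by
  rw [mills_neg, mul_div_cancel₀ _ (gCDF_pos v).ne']

lemma mills_neg_nonneg (v : ℝ) : 0 ≤ mills (-v) := by
  rw [mills_neg]
  exact (div_pos (gPDF_pos v) (gCDF_pos v)).le

lemma abs_mills_neg_sq_mul_gCDF_le (v : ℝ) :
    |mills (-v) ^ 2| * gCDF v ≤ (Real.sqrt (2 * Real.pi))⁻¹ * (Real.exp 1 + 1) := by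
  have h1 : |mills (-v) ^ 2| * gCDF v = gPDF v * mills (-v) := by
    rw [abs_of_nonneg (sq_nonneg _), ← gCDF_mul_mills_neg]; ring
  have h2 : 0 ≤ (Real.sqrt (2 * Real.pi))⁻¹ := by positivity
  linarith [gPDF_mul_mills_neg_le v]

lemma abs_mills_neg_mul_add_mul_gCDF_le (v : ℝ) :
    |mills (-v) * (mills (-v) + v)| * gCDF v ≤
      (Real.sqrt (2 * Real.pi))⁻¹ * (Real.exp 1 + 1) := by
  have h1 : |mills (-v) * (mills (-v) + v)| * gCDF v = gPDF v * |mills (-v) + v| := by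
    rw [abs_mul, abs_of_nonneg (mills_neg_nonneg v), ← gCDF_mul_mills_neg]; ring
  have h2 : |mills (-v) + v| ≤ mills (-v) + |v| :=
    (abs_add_le _ _).trans_eq (by rw [abs_of_nonneg (mills_neg_nonneg v)])
  have h3 := mul_le_mul_of_nonneg_left h2 (gPDF_pos v).le
  linarith [gPDF_mul_mills_neg_le v, abs_mul_gPDF_le v]

lemma integrable_linear_mul_linear_gaussianReal (p₁ q₁ p₂ q₂ : ℝ) :
    Integrable (fun u : ℝ => (p₁ + q₁ * u) * (p₂ + q₂ * u) + q₁ * q₂) (gaussianReal 0 1) := by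
  have := ((integrable_pow_gaussianReal 0).const_mul (p₁ * p₂ + q₁ * q₂)).add
    (((integrable_pow_gaussianReal 1).const_mul (p₁ * q₂ + p₂ * q₁)).add
      ((integrable_pow_gaussianReal 2).const_mul (q₁ * q₂)))
  refine this.congr (ae_of_all _ fun u => ?_)
  simp only [Pi.add_apply]
  ring

lemma integrable_score_mul_score_gaussianReal (p₁ q₁ p₂ q₂ : ℝ) :
    Integrable (fun u : ℝ => (u * (p₁ + q₁ * u) - q₁) * (u * (p₂ + q₂ * u) - q₂))
      (gaussianReal 0 1) := by
  have := ((integrable_pow_gaussianReal 0).const_mul (q₁ * q₂)).add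
    (((integrable_pow_gaussianReal 1).const_mul (-(p₁ * q₂ + p₂ * q₁))).add
    (((integrable_pow_gaussianReal 2).const_mul (p₁ * p₂ - 2 * q₁ * q₂)).add
    (((integrable_pow_gaussianReal 3).const_mul (p₁ * q₂ + p₂ * q₁)).add
      ((integrable_pow_gaussianReal 4).const_mul (q₁ * q₂)))))
  refine this.congr (ae_of_all _ fun u => ?_)
  simp only [Pi.add_apply]
  ring

/-- The information equality of the censored standard normal distribution for scores which are
affine in the outcome. -/
lemma integral_score_mul_score_eq (p₁ q₁ p₂ q₂ v : ℝ) :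
    ∫ u, (if u ≤ v then mills (-v) ^ 2 * ((p₁ + q₁ * v) * (p₂ + q₂ * v))
      else (u * (p₁ + q₁ * u) - q₁) * (u * (p₂ + q₂ * u) - q₂)) ∂gaussianReal 0 1 =
    ∫ u, (if u ≤ v then mills (-v) * (mills (-v) + v) * ((p₁ + q₁ * v) * (p₂ + q₂ * v))
      else (p₁ + q₁ * u) * (p₂ + q₂ * u) + q₁ * q₂) ∂gaussianReal 0 1 := by
  have key : ∀ (a : ℝ) (g : ℝ → ℝ), Integrable g (gaussianReal 0 1) →
      ∫ u, (if u ≤ v then a else g u) ∂gaussianReal 0 1 =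
        gCDF v * a + ∫ u in Ioi v, g u ∂gaussianReal 0 1 := fun a g hg => by
    have := integral_piecewise (μ := gaussianReal 0 1) (f := fun _ => a) (g := g)
      (measurableSet_Iic (a := v)) (integrable_const _).integrableOn hg.integrableOn
    rw [compl_Iic, setIntegral_const, smul_eq_mul, ← gCDF_eq_gaussianReal_real] at this
    rw [← this]
    rfl
  have hs := integrable_score_mul_score_gaussianReal p₁ q₁ p₂ q₂
  have hl := integrable_linear_mul_linear_gaussianReal p₁ q₁ p₂ q₂
  rw [key _ _ hs, key _ _ hl]
  have hd : ∀ u : ℝ, HasDerivAt (fun u : ℝ => u * ((p₁ + q₁ * u) * (p₂ + q₂ * u)))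
      ((p₁ + q₁ * u) * (p₂ + q₂ * u) + u * (q₁ * (p₂ + q₂ * u) + (p₁ + q₁ * u) * q₂)) u := fun u => by
    have h1 := ((hasDerivAt_id u).const_mul q₁).const_add p₁
    have h2 := ((hasDerivAt_id u).const_mul q₂).const_add p₂
    convert! (hasDerivAt_id u).mul (h1.mul h2) using 1
    simp
  have hi : Integrable (fun u : ℝ => u * ((p₁ + q₁ * u) * (p₂ + q₂ * u))) (gaussianReal 0 1) := by
    have := ((integrable_pow_gaussianReal 1).const_mul (p₁ * p₂)).add
      (((integrable_pow_gaussianReal 2).const_mul (p₁ * q₂ + p₂ * q₁)).add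
        ((integrable_pow_gaussianReal 3).const_mul (q₁ * q₂)))
    refine this.congr (ae_of_all _ fun u => ?_)
    simp only [Pi.add_apply]
    ring
  have heq : ∀ u : ℝ, u * (u * ((p₁ + q₁ * u) * (p₂ + q₂ * u))) -
      ((p₁ + q₁ * u) * (p₂ + q₂ * u) + u * (q₁ * (p₂ + q₂ * u) + (p₁ + q₁ * u) * q₂)) =
      (u * (p₁ + q₁ * u) - q₁) * (u * (p₂ + q₂ * u) - q₂) -
        ((p₁ + q₁ * u) * (p₂ + q₂ * u) + q₁ * q₂) := fun u => by ring
  have hstein := setIntegral_Ioi_gaussianReal_stein v hd hi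
    ((hs.sub hl).congr (ae_of_all _ fun u => (heq u).symm))
  simp only [heq] at hstein
  rw [integral_sub hs.integrableOn hl.integrableOn] at hstein
  have hm := gCDF_mul_mills_neg v
  linear_combination hstein - v * ((p₁ + q₁ * v) * (p₂ + q₂ * v)) * hm

section Joint

variable {α : Type*} [MeasurableSpace α] {ν : Measure α}

lemma integrableOn_le_prod_gaussianReal {V W k : α → ℝ} {C : ℝ} (hV : Measurable V)
    (hW : Integrable W ν) (hk : Measurable k) (hC : ∀ x, |k x| * gCDF (V x) ≤ C) :
    IntegrableOn (fun z : α × ℝ => k z.1 * W z.1) {z | z.2 ≤ V z.1}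
      (ν.prod (gaussianReal 0 1)) := by
  have hS : MeasurableSet {z : α × ℝ | z.2 ≤ V z.1} :=
    measurableSet_le measurable_snd (hV.comp measurable_fst)
  have hm : AEStronglyMeasurable (fun z : α × ℝ => k z.1 * W z.1)
      (ν.prod (gaussianReal 0 1)) :=
    (hk.comp measurable_fst).aestronglyMeasurable.mul hW.aestronglyMeasurable.comp_fst
  rw [← integrable_indicator_iff hS, integrable_prod_iff (hm.indicator hS)]
  have hsec : ∀ x, (fun u : ℝ => {z : α × ℝ | z.2 ≤ V z.1}.indicator
      (fun z : α × ℝ => k z.1 * W z.1) (x, u)) = (Iic (V x)).indicator fun _ => k x * W x := by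
    intro x
    ext u
    by_cases hu : u ≤ V x <;> simp [hu]
  have hnorm : ∀ x, ∫ u, ‖{z : α × ℝ | z.2 ≤ V z.1}.indicator
      (fun z : α × ℝ => k z.1 * W z.1) (x, u)‖ ∂gaussianReal 0 1 =
      |k x| * gCDF (V x) * |W x| := by
    intro x
    have h := fun u => congrFun (hsec x) u
    simp only [h, norm_indicator_eq_indicator_norm]
    rw [integral_indicator measurableSet_Iic, setIntegral_const, smul_eq_mul,
      ← gCDF_eq_gaussianReal_real, Real.norm_eq_abs, abs_mul]
    ring
  refine ⟨ae_of_all _ fun x => ?_, ?_⟩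
  · rw [hsec]
    exact (integrable_const _).indicator measurableSet_Iic
  · simp only [hnorm]
    refine (hW.abs.const_mul C).mono' ?_ (ae_of_all _ fun x => ?_)
    · exact ((hk.abs.mul (monotone_gCDF.measurable.comp hV)).aestronglyMeasurable).mul
        hW.abs.aestronglyMeasurable
    · rw [Real.norm_eq_abs, abs_mul, abs_abs, abs_mul, abs_abs, abs_of_pos (gCDF_pos _)]
      exact mul_le_mul_of_nonneg_right (hC x) (abs_nonneg _)

lemma integrable_linear_mul_linear_prod [IsFiniteMeasure ν] {p₁ p₂ : α → ℝ} (q₁ q₂ : ℝ)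
    (h₁ : Integrable p₁ ν) (h₂ : Integrable p₂ ν) (h₁₂ : Integrable (fun x => p₁ x * p₂ x) ν) :
    Integrable (fun z : α × ℝ => (p₁ z.1 + q₁ * z.2) * (p₂ z.1 + q₂ * z.2) + q₁ * q₂)
      (ν.prod (gaussianReal 0 1)) := by
  have := ((h₁₂.add (integrable_const (q₁ * q₂))).mul_prod (integrable_pow_gaussianReal 0)).add
    ((((h₁.const_mul q₂).add (h₂.const_mul q₁)).mul_prod (integrable_pow_gaussianReal 1)).add
      ((integrable_const (q₁ * q₂)).mul_prod (integrable_pow_gaussianReal 2)))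
  refine this.congr (ae_of_all _ fun u => ?_)
  simp only [Pi.add_apply]
  ring

lemma integrable_score_mul_score_prod [IsFiniteMeasure ν] {p₁ p₂ : α → ℝ} (q₁ q₂ : ℝ)
    (h₁ : Integrable p₁ ν) (h₂ : Integrable p₂ ν) (h₁₂ : Integrable (fun x => p₁ x * p₂ x) ν) :
    Integrable (fun z : α × ℝ => (z.2 * (p₁ z.1 + q₁ * z.2) - q₁) *
      (z.2 * (p₂ z.1 + q₂ * z.2) - q₂)) (ν.prod (gaussianReal 0 1)) := by
  have hp := (h₁.const_mul q₂).add (h₂.const_mul q₁)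
  have := ((integrable_const (q₁ * q₂)).mul_prod (integrable_pow_gaussianReal 0)).add
    ((hp.neg.mul_prod (integrable_pow_gaussianReal 1)).add
    (((h₁₂.sub (integrable_const (2 * q₁ * q₂))).mul_prod (integrable_pow_gaussianReal 2)).add
    ((hp.mul_prod (integrable_pow_gaussianReal 3)).add
      ((integrable_const (q₁ * q₂)).mul_prod (integrable_pow_gaussianReal 4)))))
  refine this.congr (ae_of_all _ fun u => ?_)
  simp only [Pi.add_apply, Pi.neg_apply, Pi.sub_apply]
  ring

lemma integrable_ite_le_prod {V : α → ℝ} (hV : Measurable V) {f g : α × ℝ → ℝ}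
    (hf : IntegrableOn f {z | z.2 ≤ V z.1} (ν.prod (gaussianReal 0 1)))
    (hg : Integrable g (ν.prod (gaussianReal 0 1))) :
    Integrable (fun z => if z.2 ≤ V z.1 then f z else g z) (ν.prod (gaussianReal 0 1)) := by
  classical
  convert! Integrable.piecewise (measurableSet_le measurable_snd (hV.comp measurable_fst)) hf
    hg.integrableOn

end Joint

/-- For independent `X` and `U`, conditioning on `X` integrates out `U`. -/
lemma condExp_comp_prodMk_of_indepFun {Ω α : Type*} [MeasurableSpace Ω] [MeasurableSpace α]
    {P : Measure Ω} [IsProbabilityMeasure P] {X : Ω → α} {U : Ω → ℝ} (hX : Measurable X)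
    (hU : Measurable U) (hindep : IndepFun X U P) {f : α × ℝ → ℝ}
    (hf : Integrable f ((P.map X).prod (P.map U))) :
    P[fun ω => f (X ω, U ω) | MeasurableSpace.comap X inferInstance] =ᵐ[P]
      fun ω => ∫ u, f (X ω, u) ∂P.map U := by
  have hmap := (indepFun_iff_map_prod_eq_prod_map_map hX.aemeasurable hU.aemeasurable).1 hindep
  have := Measure.isProbabilityMeasure_map (μ := P) hU.aemeasurable
  have hd : condDistrib U X P =ᵐ[P.map X] Kernel.const α (P.map U) :=
    condDistrib_ae_eq_of_measure_eq_compProd X hU.aemeasurable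
      (by rw [hmap, Measure.compProd_const])
  have h := condExp_prod_ae_eq_integral_condDistrib' hX hU.aemeasurable (μ := P) (f := f)
    (by rw [hmap]; exact hf)
  filter_upwards [h, ae_of_ae_map hX.aemeasurable hd] with ω h1 h2
  rw [h1, h2, Kernel.const_apply]

/-- The intercept, in the standardized error, of the affine factor of the Tobit score. -/
def scoreIntercept {K : ℕ} (x δ : Fin K → ℝ) (σ : ℝ) : Fin K ⊕ Unit → ℝ :=
  Sum.elim x fun _ => -(σ * dotp x δ)

/-- The slope, in the standardized error, of the affine factor of the Tobit score. -/
def scoreSlope (K : ℕ) (σ : ℝ) : Fin K ⊕ Unit → ℝ :=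
  Sum.elim (fun _ => 0) fun _ => -σ

lemma tobitScore_mul_tobitScore {K : ℕ} {c σ : ℝ} (hσ : σ ≠ 0) (x δ : Fin K → ℝ) (u : ℝ)
    (i j : Fin K ⊕ Unit) :
    tobitScore K c (if u ≤ 1 / σ * c - dotp x δ then c else σ * (dotp x δ + u)) x
        (if u ≤ 1 / σ * c - dotp x δ then 1 else 0) δ (1 / σ) i *
      tobitScore K c (if u ≤ 1 / σ * c - dotp x δ then c else σ * (dotp x δ + u)) x
        (if u ≤ 1 / σ * c - dotp x δ then 1 else 0) δ (1 / σ) j =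
    if u ≤ 1 / σ * c - dotp x δ then
      mills (-(1 / σ * c - dotp x δ)) ^ 2 *
        ((scoreIntercept x δ σ i + scoreSlope K σ i * (1 / σ * c - dotp x δ)) *
          (scoreIntercept x δ σ j + scoreSlope K σ j * (1 / σ * c - dotp x δ)))
    else (u * (scoreIntercept x δ σ i + scoreSlope K σ i * u) - scoreSlope K σ i) *
      (u * (scoreIntercept x δ σ j + scoreSlope K σ j * u) - scoreSlope K σ j) := by
  by_cases h : u ≤ 1 / σ * c - dotp x δ
  · simp only [h, if_true, tobitScore]
    generalize mills (-(1 / σ * c - dotp x δ)) = m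
    have hc : -(σ * dotp x δ) + -σ * (1 / σ * c - dotp x δ) = -c := by field_simp; ring
    rcases i with i | i <;> rcases j with j | j <;>
      simp only [scoreIntercept, scoreSlope, Sum.elim_inl, Sum.elim_inr, hc] <;> ring
  · simp only [h, if_false, tobitScore]
    rcases i with i | i <;> rcases j with j | j <;>
      simp [scoreIntercept, scoreSlope] <;> field_simp <;> ring

lemma neg_tobitHess_apply {K : ℕ} {c σ : ℝ} (hσ : σ ≠ 0) (x δ : Fin K → ℝ) (u : ℝ)
    (i j : Fin K ⊕ Unit) :
    -(tobitHess K c (if u ≤ 1 / σ * c - dotp x δ then c else σ * (dotp x δ + u)) x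
        (if u ≤ 1 / σ * c - dotp x δ then 1 else 0) δ (1 / σ) i j) =
    if u ≤ 1 / σ * c - dotp x δ then
      mills (-(1 / σ * c - dotp x δ)) *
        (mills (-(1 / σ * c - dotp x δ)) + (1 / σ * c - dotp x δ)) *
        ((scoreIntercept x δ σ i + scoreSlope K σ i * (1 / σ * c - dotp x δ)) *
          (scoreIntercept x δ σ j + scoreSlope K σ j * (1 / σ * c - dotp x δ)))
    else (scoreIntercept x δ σ i + scoreSlope K σ i * u) *
      (scoreIntercept x δ σ j + scoreSlope K σ j * u) + scoreSlope K σ i * scoreSlope K σ j := by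
  by_cases h : u ≤ 1 / σ * c - dotp x δ
  · simp only [h, if_true, tobitHess]
    generalize mills (-(1 / σ * c - dotp x δ)) = m
    have hc : -(σ * dotp x δ) + -σ * (1 / σ * c - dotp x δ) = -c := by field_simp; ring
    rcases i with i | i <;> rcases j with j | j <;>
      simp only [scoreIntercept, scoreSlope, Sum.elim_inl, Sum.elim_inr, hc] <;>
      simp [blockB, Matrix.vecMulVec_apply, -mul_eq_mul_left_iff, -mul_eq_mul_right_iff] <;> ring
  · simp only [h, if_false, tobitHess]
    rcases i with i | i <;> rcases j with j | j <;>
      simp [scoreIntercept, scoreSlope, blockA, Matrix.vecMulVec_apply] <;> ring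

lemma measurable_dotp {K : ℕ} (δ : Fin K → ℝ) : Measurable fun x : Fin K → ℝ => dotp x δ := by
  unfold dotp; fun_prop

lemma memLp_scoreIntercept {K : ℕ} {ν : Measure (Fin K → ℝ)}
    (hν : Integrable (fun x => vnorm x ^ 2) ν) (δ : Fin K → ℝ) (σ : ℝ) (j : Fin K ⊕ Unit) :
    MemLp (fun x => scoreIntercept x δ σ j) 2 ν := by
  have hcoord : ∀ i, MemLp (fun x : Fin K → ℝ => x i) 2 ν := fun i => by
    rw [memLp_two_iff_integrable_sq (measurable_pi_apply i).aestronglyMeasurable]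
    refine hν.mono' ((measurable_pi_apply i).pow_const 2).aestronglyMeasurable (ae_of_all _ fun x => ?_)
    rw [vnorm, Real.sq_sqrt (Finset.sum_nonneg fun _ _ => sq_nonneg _), Real.norm_eq_abs, abs_sq]
    exact Finset.single_le_sum (f := fun i => x i ^ 2) (fun _ _ => sq_nonneg _)
      (Finset.mem_univ i)
  rcases j with i | _
  · exact hcoord i
  · have := memLp_finsetSum Finset.univ fun i (_ : i ∈ Finset.univ) => (hcoord i).mul_const (δ i)
    exact (this.const_mul σ).neg

lemma map_div_gaussianReal {Ω : Type*} [MeasurableSpace Ω] {P : Measure Ω} {ε : Ω → ℝ}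
    (hε : Measurable ε) {σ : ℝ} (hσ : 0 < σ)
    (h : P.map ε = gaussianReal 0 (.mk (σ ^ 2) (sq_nonneg σ))) :
    P.map (fun ω => ε ω / σ) = gaussianReal 0 1 := by
  have h1 : P.map (fun ω => ε ω / σ) = (P.map ε).map (· / σ) := by
    rw [Measure.map_map (by fun_prop) hε]; rfl
  rw [h1, h, gaussianReal_map_div_const, zero_div]
  congr 1
  exact div_self (ne_of_gt (show (0 : ℝ≥0) < .mk (σ ^ 2) (sq_nonneg σ) from pow_pos hσ 2))

/-- Conditional information equality for the Tobit model at the true parameters: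
`E[s sᵀ | X] = -E[H | X]` almost surely, entrywise. -/
theorem tobit_conditional_information_equality (K : ℕ) (hK : 0 < K) {Ω : Type*} [MeasurableSpace Ω]
    (P : Measure Ω) [IsProbabilityMeasure P]
    (X : Ω → Fin K → ℝ) (hX : Measurable X) (ε : Ω → ℝ) (hε : Measurable ε)
    (σ₀ : ℝ) (hσ : 0 < σ₀)
    (hgauss : Measure.map ε P = gaussianReal 0 ⟨σ₀ ^ 2, sq_nonneg σ₀⟩)
    (hindep : IndepFun X ε P)
    (β₀ : Fin K → ℝ) (c : ℝ)
    (Y : Ω → ℝ) (hY : ∀ ω, Y ω = max (dotp (X ω) β₀ + ε ω) c)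
    (D : Ω → ℝ) (hD : ∀ ω, D ω = if dotp (X ω) β₀ + ε ω ≤ c then 1 else 0)
    (δ₀ : Fin K → ℝ) (hδ₀ : δ₀ = fun i => β₀ i / σ₀) (γ₀ : ℝ) (hγ₀ : γ₀ = 1 / σ₀)
    (hint : Integrable (fun ω => vnorm (X ω) ^ 2) P) :
    ∀ i j, P[(fun ω => tobitScore K c (Y ω) (X ω) (D ω) δ₀ γ₀ i *
        tobitScore K c (Y ω) (X ω) (D ω) δ₀ γ₀ j) |
      MeasurableSpace.comap X inferInstance] =ᵐ[P]
      P[(fun ω => -(tobitHess K c (Y ω) (X ω) (D ω) δ₀ γ₀ i j)) |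
        MeasurableSpace.comap X inferInstance] := by
  intro i j
  have hσ' := hσ.ne'
  subst hγ₀
  have hdot : ∀ x, σ₀ * dotp x δ₀ = dotp x β₀ := fun x => by
    simp only [dotp, hδ₀, Finset.mul_sum]
    refine Finset.sum_congr rfl fun k _ => ?_
    field_simp
  have hcens : ∀ ω, dotp (X ω) β₀ + ε ω ≤ c ↔ ε ω / σ₀ ≤ 1 / σ₀ * c - dotp (X ω) δ₀ := fun ω => by
    rw [← hdot, div_le_iff₀ hσ, sub_mul, one_div, mul_right_comm, inv_mul_cancel₀ hσ', one_mul,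
      mul_comm σ₀]
    constructor <;> intro h <;> linarith
  have hD' : ∀ ω, D ω = if ε ω / σ₀ ≤ 1 / σ₀ * c - dotp (X ω) δ₀ then 1 else 0 := fun ω => by
    rw [hD]; simp only [hcens]
  have hY' : ∀ ω, Y ω = if ε ω / σ₀ ≤ 1 / σ₀ * c - dotp (X ω) δ₀ then c else
      σ₀ * (dotp (X ω) δ₀ + ε ω / σ₀) := fun ω => by
    simp only [hY, ← hcens, mul_add, hdot, mul_div_cancel₀ _ hσ', max_def]
  simp only [hD', hY', tobitScore_mul_tobitScore hσ', neg_tobitHess_apply hσ']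
  have hU : Measurable fun ω => ε ω / σ₀ := hε.div_const σ₀
  have hmapU := map_div_gaussianReal hε hσ hgauss
  have hind : IndepFun X (fun ω => ε ω / σ₀) P :=
    hindep.comp (φ := id) (ψ := (· / σ₀)) measurable_id (by fun_prop)
  have : IsProbabilityMeasure (P.map X) := Measure.isProbabilityMeasure_map hX.aemeasurable
  have hν : Integrable (fun x : Fin K → ℝ => vnorm x ^ 2) (P.map X) :=
    (integrable_map_measure (by unfold vnorm; exact Measurable.aestronglyMeasurable (by fun_prop)) hX.aemeasurable).2 hint
  have hp := memLp_scoreIntercept hν δ₀ σ₀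
  have hp1 := fun k => (hp k).integrable one_le_two
  have hp2 := (hp i).integrable_mul (hp j)
  have hV : Measurable fun x : Fin K → ℝ => 1 / σ₀ * c - dotp x δ₀ :=
    measurable_const.sub (measurable_dotp δ₀)
  have hslope : ∀ k (x : Fin K → ℝ), scoreIntercept x δ₀ σ₀ k +
      scoreSlope K σ₀ k * (1 / σ₀ * c - dotp x δ₀) = Sum.elim x (fun _ => -c) k := fun k x => by
    rcases k with k | k <;> simp [scoreIntercept, scoreSlope]
    field_simp
    ring
  have hW : ∀ k, MemLp (fun x : Fin K → ℝ => scoreIntercept x δ₀ σ₀ k +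
      scoreSlope K σ₀ k * (1 / σ₀ * c - dotp x δ₀)) 2 (P.map X) := fun k => by
    simp only [hslope]
    rcases k with k | k
    · exact hp (Sum.inl k)
    · exact memLp_const _
  have hWW := (hW i).integrable_mul (hW j)
  have hmills := measurable_mills.comp hV.neg
  have hS := integrable_ite_le_prod hV
    (integrableOn_le_prod_gaussianReal hV hWW (hmills.pow_const 2)
      fun x => abs_mills_neg_sq_mul_gCDF_le _)
    (integrable_score_mul_score_prod (scoreSlope K σ₀ i) (scoreSlope K σ₀ j) (hp1 i) (hp1 j) hp2)
  have hH := integrable_ite_le_prod hV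
    (integrableOn_le_prod_gaussianReal hV hWW (hmills.mul (hmills.add hV))
      fun x => abs_mills_neg_mul_add_mul_gCDF_le _)
    (integrable_linear_mul_linear_prod (scoreSlope K σ₀ i) (scoreSlope K σ₀ j)
      (hp1 i) (hp1 j) hp2)
  rw [← hmapU] at hS hH
  refine (condExp_comp_prodMk_of_indepFun hX hU hind hS).trans
    (EventuallyEq.trans ?_ (condExp_comp_prodMk_of_indepFun hX hU hind hH).symm)
  refine ae_of_all _ fun ω => ?_
  rw [hmapU]
  exact integral_score_mul_score_eq (scoreIntercept (X ω) δ₀ σ₀ i) (scoreSlope K σ₀ i)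
    (scoreIntercept (X ω) δ₀ σ₀ j) (scoreSlope K σ₀ j) (1 / σ₀ * c - dotp (X ω) δ₀)
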